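/- arXiv:1707.08481 — 2 statements merged into one kernel-verified Lean document; each statement's English description precedes it below -/
import Mathlib

section
/- Let N, W, n be positive integers with W, n ≤ N, p := W/N ∈ (0,1), and np(1−p) ≥ 1. Then δ(H(N,W,n), B(n,p)) ≥ (1/28)·(n−1)/(N−1). -/
/-- pmf of the hypergeometric distribution `H(N,W,n)` at `k`. -/
noncomputable def hyperPMF (N W n k : ℕ) : ℝ :=
  ((W.choose k : ℝ) * ((N - W).choose (n - k) : ℝ)) / (N.choose n : ℝ)

/-- pmf of the binomial distribution `B(n,p)` at `k`. -/
noncomputable def binomPMF (n : ℕ) (p : ℝ) (k : ℕ) : ℝ :=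
  (n.choose k : ℝ) * p ^ k * (1 - p) ^ (n - k)

/-- total variation distance between `H(N,W,n)` and `B(n,p)`, as the maximal
deviation over subsets `A` of `{0,1,…,n}`. -/
noncomputable def tvDist (N W n : ℕ) (p : ℝ) : ℝ :=
  ⨆ A : Finset (Fin (n+1)), |∑ k ∈ A, (hyperPMF N W n k - binomPMF n p k)|

open Finset

/-- Total variation distance controls expectations of bounded functions. -/
lemma sum_mul_sub_le_tvDist (N W n : ℕ) (p : ℝ) (f : ℕ → ℝ) (l u : ℝ)
    (hl : ∀ k ≤ n, l ≤ f k) (hu : ∀ k ≤ n, f k ≤ u)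
    (h : ∑ k ∈ range (n + 1), (hyperPMF N W n k - binomPMF n p k) = 0) :
    ∑ k ∈ range (n + 1), f k * (hyperPMF N W n k - binomPMF n p k)
      ≤ (u - l) * tvDist N W n p := by
  set d : ℕ → ℝ := fun k => hyperPMF N W n k - binomPMF n p k with hd
  have hlu : 0 ≤ u - l := by linarith [hl 0 n.zero_le, hu 0 n.zero_le]
  let A : Finset (Fin (n + 1)) := univ.filter fun k => 0 ≤ d k
  have hA : ∑ k ∈ A, d k ≤ tvDist N W n p := by
    refine (le_abs_self _).trans ?_
    exact le_ciSup (f := fun A : Finset (Fin (n + 1)) => |∑ k ∈ A, d k|)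
      (Set.finite_range _).bddAbove A
  calc ∑ k ∈ range (n + 1), f k * d k
      = ∑ k ∈ range (n + 1), (f k - l) * d k + l * ∑ k ∈ range (n + 1), d k := by
        rw [mul_sum, ← sum_add_distrib]
        exact sum_congr rfl fun k _ => by ring
    _ = ∑ k : Fin (n + 1), (f k - l) * d k := by
        rw [h, mul_zero, add_zero, Fin.sum_univ_eq_sum_range (fun k => (f k - l) * d k)]
    _ ≤ ∑ k : Fin (n + 1), if 0 ≤ d k then (u - l) * d k else 0 := by
        refine sum_le_sum fun k _ => ?_
        have h1 := hl k (Nat.lt_succ_iff.mp k.2)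
        have h2 := hu k (Nat.lt_succ_iff.mp k.2)
        split_ifs with h0
        · exact mul_le_mul_of_nonneg_right (by linarith) h0
        · exact mul_nonpos_of_nonneg_of_nonpos (by linarith) (by linarith)
    _ = (u - l) * ∑ k ∈ A, d k := by
        rw [← sum_filter, mul_sum]
    _ ≤ _ := mul_le_mul_of_nonneg_left hA hlu

lemma cast_choose_mul_sub (n k : ℕ) :
    (n.choose k : ℝ) * (n - k) = n.choose (k + 1) * (k + 1) := by
  rcases le_or_gt k n with h | h
  · have := Nat.choose_succ_right_eq n k
    have h2 : ((n.choose (k + 1) * (k + 1) : ℕ) : ℝ) = ((n.choose k * (n - k) : ℕ) : ℝ) := by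
      rw [this]
    push_cast [Nat.cast_sub h] at h2
    linarith
  · simp [Nat.choose_eq_zero_of_lt h, Nat.choose_eq_zero_of_lt (h.trans (Nat.lt_succ_self k))]

lemma sum_binomPMF (n : ℕ) (p : ℝ) : ∑ k ∈ range (n + 1), binomPMF n p k = 1 := by
  have := add_pow p (1 - p) n
  rw [add_sub_cancel, one_pow] at this
  rw [this]
  exact sum_congr rfl fun k _ => by unfold binomPMF; ring

/-- The Stein identity of the binomial distribution. -/
lemma sum_binomPMF_stein (n : ℕ) (p : ℝ) (g : ℕ → ℝ) :
    ∑ k ∈ range (n + 1),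
      (p * (n - k) * g (k + 1) - (1 - p) * k * g k) * binomPMF n p k = 0 := by
  have key : ∀ k ∈ range (n + 1),
      (p * (n - k) * g (k + 1) - (1 - p) * k * g k) * binomPMF n p k =
      (1 - p) * (k + 1 : ℕ) * g (k + 1) * binomPMF n p (k + 1)
        - (1 - p) * k * g k * binomPMF n p k := by
    intro k hk
    have h := cast_choose_mul_sub n k
    unfold binomPMF
    rcases (Nat.lt_succ_iff.mp (mem_range.mp hk)).lt_or_eq with hlt | rfl
    · obtain ⟨j, rfl⟩ := Nat.exists_eq_add_of_lt hlt
      have e1 : k + j + 1 - k = j + 1 := by omega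
      have e2 : k + j + 1 - (k + 1) = j := by omega
      rw [e1, e2]
      push_cast at h ⊢
      linear_combination p * g (k + 1) * p ^ k * (1 - p) ^ (j + 1) * h
    · simp
  rw [sum_congr rfl key,
    sum_range_sub (fun k => (1 - p) * (k : ℕ) * g k * binomPMF n p k)]
  simp [binomPMF]

lemma sum_choose_mul_choose (a b n : ℕ) :
    ∑ k ∈ range (n + 1), (a.choose k : ℝ) * b.choose (n - k) = (a + b).choose n := by
  rw [Nat.add_choose_eq, Nat.sum_antidiagonal_eq_sum_range_succ_mk]
  push_cast
  rfl

/-- The Stein identity of the hypergeometric distribution. -/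
lemma sum_choose_stein (a b n : ℕ) (g : ℕ → ℝ) :
    ∑ k ∈ range (n + 1), ((a - k) * (n - k) * g (k + 1) - k * (b - n + k) * g k) *
      ((a.choose k : ℝ) * b.choose (n - k)) = 0 := by
  rw [sum_congr rfl (fun k _ => sub_mul _ _ _), sum_sub_distrib, sum_range_succ, sum_range_succ' (fun k : ℕ => (k : ℝ) * (b - n + k) * g k *
    ((a.choose k : ℝ) * b.choose (n - k)))]
  simp only [sub_self, mul_zero, zero_mul, add_zero, Nat.cast_zero]
  rw [← sum_sub_distrib]
  refine sum_eq_zero fun k hk => ?_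
  obtain ⟨j, rfl⟩ := Nat.exists_eq_add_of_lt (mem_range.mp hk)
  have e1 : k + j + 1 - k = j + 1 := by omega
  have e2 : k + j + 1 - (k + 1) = j := by omega
  rw [e1, e2]
  have h1 := cast_choose_mul_sub a k
  have h2 := cast_choose_mul_sub b j
  push_cast
  linear_combination (j + 1) * g (k + 1) * (b.choose (j + 1) : ℝ) * h1
    - (a.choose (k + 1) : ℝ) * (k + 1) * g (k + 1) * h2

lemma cast_succ_mul_choose (a k : ℕ) :
    ((k : ℝ) + 1) * a.choose (k + 1) = a * (a - 1).choose k := by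
  cases a with
  | zero => simp
  | succ a =>
    have := Nat.add_one_mul_choose_eq a k
    have h : (((a + 1) * a.choose k : ℕ) : ℝ) = (((a + 1).choose (k + 1) * (k + 1) : ℕ) : ℝ) := by
      rw [this]
    push_cast [Nat.add_sub_cancel] at h ⊢
    linarith

lemma sum_mul_choose_left (a b n : ℕ) (G : ℕ → ℝ) :
    ∑ k ∈ range (n + 2), k * G k * ((a.choose k : ℝ) * b.choose (n + 1 - k)) =
      a * ∑ k ∈ range (n + 1), G (k + 1) * (((a - 1).choose k : ℝ) * b.choose (n - k)) := by
  rw [sum_range_succ', mul_sum]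
  simp only [Nat.cast_zero, zero_mul, add_zero, Nat.add_sub_add_right]
  refine sum_congr rfl fun k _ => ?_
  have := cast_succ_mul_choose a k
  push_cast
  linear_combination G (k + 1) * (b.choose (n - k) : ℝ) * this

lemma sum_mul_choose_right (a b n : ℕ) (G : ℕ → ℝ) :
    ∑ k ∈ range (n + 2), ((n + 1 : ℝ) - k) * G k * ((a.choose k : ℝ) * b.choose (n + 1 - k)) =
      b * ∑ k ∈ range (n + 1), G k * ((a.choose k : ℝ) * (b - 1).choose (n - k)) := by
  rw [sum_range_succ, mul_sum]
  have h0 : ((n + 1 : ℝ) - ((n + 1 : ℕ) : ℝ)) = 0 := by push_cast; ring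
  rw [h0, zero_mul, zero_mul, add_zero]
  refine sum_congr rfl fun k hk => ?_
  obtain ⟨j, rfl⟩ := Nat.exists_eq_add_of_le (Nat.lt_succ_iff.mp (mem_range.mp hk))
  have e1 : k + j + 1 - k = j + 1 := by omega
  have e2 : k + j - k = j := by omega
  rw [e1, e2]
  have := cast_succ_mul_choose b j
  push_cast
  linear_combination G k * (a.choose k : ℝ) * this

/-- Second moment of the hypergeometric distribution about `-c`. -/
lemma sum_sq_choose_mul_choose (a b m : ℕ) (c : ℝ) (hm : 2 ≤ m) (hM : 2 ≤ a + b) :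
    ∑ k ∈ range (m + 1), ((k : ℝ) + c) ^ 2 * ((a.choose k : ℝ) * b.choose (m - k)) =
      (a + b).choose m * ((a : ℝ) * (a - 1) * m * (m - 1) / ((a + b) * (a + b - 1))
        + (2 * c + 1) * a * m / (a + b) + c ^ 2) := by
  obtain ⟨m, rfl⟩ := Nat.exists_eq_add_of_le' hm
  have hM' : (2 : ℝ) ≤ a + b := by exact_mod_cast hM
  have h0 := sum_choose_mul_choose a b (m + 2)
  have h1 : ∑ k ∈ range (m + 3), (k : ℝ) * ((a.choose k : ℝ) * b.choose (m + 2 - k)) =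
      a * (a + b - 1).choose (m + 1) := by
    have := sum_mul_choose_left a b (m + 1) (fun _ => 1)
    simp only [mul_one, one_mul] at this
    rw [this, sum_choose_mul_choose]
    rcases a.eq_zero_or_pos with rfl | ha
    · simp
    · rw [show a - 1 + b = a + b - 1 by omega]
  have h2 : ∑ k ∈ range (m + 3), (k : ℝ) * (k - 1) * ((a.choose k : ℝ) * b.choose (m + 2 - k)) =
      a * (a - 1) * (a + b - 2).choose m := by
    rw [sum_mul_choose_left a b (m + 1) (fun k => (k : ℝ) - 1)]
    have := sum_mul_choose_left (a - 1) b m (fun _ => 1)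
    simp only [mul_one, one_mul] at this
    push_cast
    simp only [add_sub_cancel_right]
    rw [this, sum_choose_mul_choose]
    rcases a with _ | _ | a
    · simp
    · simp
    · rw [show a + 1 + 1 - 1 - 1 + b = a + 1 + 1 + b - 2 by omega]
      push_cast [Nat.add_sub_cancel]
      ring
  have c1 := cast_succ_mul_choose (a + b) (m + 1)
  have c2 := cast_succ_mul_choose (a + b - 1) m
  rw [Nat.cast_sub (by omega), Nat.sub_sub] at c2
  push_cast at c1 c2
  have e : ∀ k : ℕ, ((k : ℝ) + c) ^ 2 * ((a.choose k : ℝ) * b.choose (m + 2 - k)) =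
      (k : ℝ) * (k - 1) * ((a.choose k : ℝ) * b.choose (m + 2 - k))
      + (2 * c + 1) * ((k : ℝ) * ((a.choose k : ℝ) * b.choose (m + 2 - k)))
      + c ^ 2 * ((a.choose k : ℝ) * b.choose (m + 2 - k)) := fun k => by ring
  simp only [e, sum_add_distrib, ← mul_sum]
  rw [h0, h1, h2]
  have n1 : (a : ℝ) + b ≠ 0 := by linarith
  have n2 : (a : ℝ) + b - 1 ≠ 0 := by linarith
  have d1 : ((a + b - 1).choose (m + 1) : ℝ) = (m + 2) * (a + b).choose (m + 2) / (a + b) := by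
    rw [eq_div_iff n1]; linear_combination -c1
  have d2 : ((a + b - 2).choose m : ℝ) =
      (m + 1) * (a + b - 1).choose (m + 1) / (a + b - 1) := by
    rw [eq_div_iff n2]; linear_combination -c2
  rw [d2, d1]
  push_cast
  field_simp
  ring

/-- The second moment of `1 + Y - n p`, with `Y ~ H(N - 2, W - 1, n - 2)`, is at most
`n p (1 - p) + 1`. -/
lemma shifted_second_moment_le {N W n p : ℝ} (hp : W = p * N) (hn : 4 ≤ n) (hnN : n ≤ N)
    (hp0 : 0 < p) (hp1 : p < 1) :
    (W - 1) * (W - 2) * (n - 2) * (n - 3) / ((N - 2) * (N - 3))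
      + (2 * (1 - n * p) + 1) * (W - 1) * (n - 2) / (N - 2) + (1 - n * p) ^ 2
      ≤ n * p * (1 - p) + 1 := by
  have h2 : 0 < N - 2 := by linarith
  have h3 : 0 < N - 3 := by linarith
  have hpq : 0 < p * (1 - p) := mul_pos hp0 (by linarith)
  have e : (W - 1) * (W - 2) * (n - 2) * (n - 3) / ((N - 2) * (N - 3))
      + (2 * (1 - n * p) + 1) * (W - 1) * (n - 2) / (N - 2) + (1 - n * p) ^ 2
      = ((W - 1) * (N - W - 1) / (N - 2) ^ 2) * (n - 2) * ((N - n) / (N - 3))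
        + ((1 - 2 * p) * ((N - n) / (N - 2))) ^ 2 := by
    subst hp
    field_simp
    ring
  rw [e]
  have b1 : (W - 1) * (N - W - 1) / (N - 2) ^ 2 ≤ p * (1 - p) := by
    rw [div_le_iff₀ (by positivity)]
    subst hp
    nlinarith [mul_nonneg (by linarith : (0 : ℝ) ≤ N - 1) (sq_nonneg (2 * p - 1))]
  have b2 : (N - n) / (N - 3) ≤ 1 := by rw [div_le_one h3]; linarith
  have b2' : 0 ≤ (N - n) / (N - 3) := div_nonneg (by linarith) h3.le
  have b3 : (N - n) / (N - 2) ≤ 1 := by rw [div_le_one h2]; linarith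
  have b3' : 0 ≤ (N - n) / (N - 2) := div_nonneg (by linarith) h2.le
  have t1 : ((W - 1) * (N - W - 1) / (N - 2) ^ 2) * (n - 2) * ((N - n) / (N - 3))
      ≤ p * (1 - p) * (n - 2) := by
    have hq : 0 ≤ p * (1 - p) * (n - 2) := mul_nonneg hpq.le (by linarith)
    calc _ ≤ p * (1 - p) * (n - 2) * ((N - n) / (N - 3)) :=
          mul_le_mul_of_nonneg_right (mul_le_mul_of_nonneg_right b1 (by linarith)) b2'
      _ ≤ _ := mul_le_of_le_one_right hq b2
  have t2 : ((1 - 2 * p) * ((N - n) / (N - 2))) ^ 2 ≤ 1 := by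
    rw [sq_le_one_iff_abs_le_one, abs_mul, abs_of_nonneg b3']
    exact mul_le_one₀ (abs_le.mpr ⟨by linarith, by linarith⟩) b3' b3
  nlinarith

/-- The bounded test function in the Stein equation, in the variable `x = k - n p`. -/
noncomputable def steinTest (C x : ℝ) : ℝ := C * (x - 1 / 2) / (C + (x - 1 / 2) ^ 2)

lemma steinTest_sub {C : ℝ} (hC : 0 < C) (x : ℝ) :
    steinTest C (x + 1) - steinTest C x =
      C * (C + 1 / 4 - x ^ 2) / ((C + (x - 1 / 2) ^ 2) * (C + (x + 1 / 2) ^ 2)) := by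
  have h0 : C + (x - 1 / 2) ^ 2 ≠ 0 := by positivity
  have h1 : C + (x + 1 / 2) ^ 2 ≠ 0 := by positivity
  unfold steinTest
  rw [show x + 1 - 1 / 2 = x + 1 / 2 by ring, div_sub_div _ _ h1 h0, mul_comm (C + (x - 1 / 2) ^ 2),
    div_left_inj' (mul_ne_zero h1 h0)]
  ring

lemma steinTest_sub_le {C : ℝ} (hC : 1 ≤ C) (x : ℝ) :
    steinTest C (x + 1) - steinTest C x ≤ 1 := by
  rw [steinTest_sub (by linarith), div_le_one (by positivity)]
  nlinarith [sq_nonneg x, sq_nonneg (x ^ 2), mul_nonneg (by linarith : 0 ≤ C - 1) (sq_nonneg x)]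

lemma neg_le_steinTest_sub {C : ℝ} (hC : 1 ≤ C) (x : ℝ) :
    -(1 / 8) ≤ steinTest C (x + 1) - steinTest C x := by
  rw [steinTest_sub (by linarith), le_div_iff₀ (by positivity)]
  nlinarith [sq_nonneg (x ^ 2 - 3 * (C + 1 / 4) + 1 / 2)]

lemma linear_le_steinTest_sub {C : ℝ} (hC : 5 ≤ C) (x : ℝ) :
    7 / 10 - 9 / (8 * (C + 1 / 4)) * x ^ 2 ≤ steinTest C (x + 1) - steinTest C x := by
  obtain ⟨A, rfl⟩ : ∃ A, C = A - 1 / 4 := ⟨C + 1 / 4, by ring⟩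
  rw [steinTest_sub (by linarith), le_div_iff₀ (by
    have : 0 < A - 1 / 4 := by linarith
    positivity)]
  have hA : 21 / 4 ≤ A := by linarith
  have hA0 : 0 < A := by linarith
  obtain ⟨t, ht0, ht⟩ : ∃ t, 0 ≤ t ∧ x ^ 2 = A * t :=
    ⟨x ^ 2 / A, by positivity, by field_simp⟩
  have e1 : 9 / (8 * (A - 1 / 4 + 1 / 4)) * x ^ 2 = 9 / 8 * t := by
    rw [ht]; field_simp; ring
  have e2 : (A - 1 / 4 + (x - 1 / 2) ^ 2) * (A - 1 / 4 + (x + 1 / 2) ^ 2)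
      = A ^ 2 * (1 + t) ^ 2 - A * t := by
    have : (A - 1 / 4 + (x - 1 / 2) ^ 2) * (A - 1 / 4 + (x + 1 / 2) ^ 2)
      = (A + x ^ 2) ^ 2 - x ^ 2 := by ring
    rw [this, ht]; ring
  rw [e1, e2, ht]
  have cubic : 0 ≤ (21 / 4) * ((1 - t) - (7 / 10 - 9 / 8 * t) * (1 + t) ^ 2)
      - 1 / 4 * (1 - t) + (7 / 10 - 9 / 8 * t) * t := by
    nlinarith [mul_nonneg ht0 (sq_nonneg (t - 1 / 3)), sq_nonneg (t - 1 / 3), sq_nonneg t]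
  have cubic' : 0 ≤ (1 - t) - (7 / 10 - 9 / 8 * t) * (1 + t) ^ 2 := by
    nlinarith [mul_nonneg ht0 (sq_nonneg (t - 1 / 3)), sq_nonneg (t - 1 / 3), sq_nonneg t]
  nlinarith [mul_nonneg hA0.le (add_nonneg cubic (mul_nonneg (sub_nonneg.mpr hA) cubic'))]

lemma neg_le_mul_steinTest {C : ℝ} (hC : 0 < C) (x : ℝ) : -(1 / 16) ≤ x * steinTest C x := by
  unfold steinTest
  rw [← mul_div_assoc, le_div_iff₀ (by positivity)]
  nlinarith [mul_nonneg hC.le (sq_nonneg (x - 1 / 4)), sq_nonneg (x - 1 / 2)]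

lemma mul_steinTest_le {C : ℝ} (hC : 0 < C) (x : ℝ) : x * steinTest C x ≤ C + 1 / 16 := by
  unfold steinTest
  rw [← mul_div_assoc, div_le_iff₀ (by positivity)]
  nlinarith [sq_nonneg (x - 1 / 2 - 4 * C)]

lemma steinTest_neg (C x : ℝ) : steinTest C (1 - x) = -steinTest C x := by
  unfold steinTest
  rw [← neg_div]
  congr 1 <;> ring

lemma neg_le_mul_steinTest_succ {C : ℝ} (hC : 0 < C) (x : ℝ) :
    -(1 / 16) ≤ x * steinTest C (x + 1) := by
  have h := neg_le_mul_steinTest hC (-x)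
  have e := steinTest_neg C (-x)
  rw [sub_neg_eq_add, add_comm] at e
  rw [e]; linarith

lemma mul_steinTest_succ_le {C : ℝ} (hC : 0 < C) (x : ℝ) :
    x * steinTest C (x + 1) ≤ C + 1 / 16 := by
  have h := mul_steinTest_le hC (-x)
  have e := steinTest_neg C (-x)
  rw [sub_neg_eq_add, add_comm] at e
  rw [e]; linarith

lemma stein_range_div_le {v : ℝ} (hv : 1 ≤ v) :
    (v + 1 / 16 - -(4 * v + 1 + 1 / 16 + v / 8)) / 28 ≤
      v * (7 / 10 - 9 / (8 * (4 * v + 1 + 1 / 4)) * (v + 1)) := by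
  have hA : 0 < 4 * v + 1 + 1 / 4 := by linarith
  have e : v * (7 / 10 - 9 / (8 * (4 * v + 1 + 1 / 4)) * (v + 1)) =
      (v * (7 / 10 * (4 * v + 1 + 1 / 4) - 9 / 8 * (v + 1))) / (4 * v + 1 + 1 / 4) := by
    field_simp
  rw [e, le_div_iff₀ hA]
  nlinarith

/-- The expectation of a binomial Stein operator under the hypergeometric law `H(W + V, W, m + 2)`
is an expectation of increments under `H(W + V - 2, W - 1, m)`. -/
lemma sum_hyperPMF_stein (W V m : ℕ) (p : ℝ) (hW : 0 < W) (hWp : (W : ℝ) = p * (W + V))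
    (hm : m + 2 ≤ W + V) (g : ℕ → ℝ) :
    ∑ k ∈ range (m + 2 + 1), (p * (((m + 2 : ℕ) : ℝ) - k) * g (k + 1) - (1 - p) * k * g k) *
        hyperPMF (W + V) W (m + 2) k =
      (W * V * ∑ k ∈ range (m + 1), (g (k + 1 + 1) - g (k + 1)) *
        (((W - 1).choose k : ℝ) * (V - 1).choose (m - k))) /
        ((W + V : ℝ) * (W + V).choose (m + 2)) := by
  have hch : (0 : ℝ) < (W + V).choose (m + 2) := by exact_mod_cast Nat.choose_pos hm
  have hT : (0 : ℝ) < W + V := by positivity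
  have hred : W * V * ∑ k ∈ range (m + 1), (g (k + 1 + 1) - g (k + 1)) *
        (((W - 1).choose k : ℝ) * (V - 1).choose (m - k)) =
      ∑ k ∈ range (m + 2 + 1), (k : ℝ) * ((((m + 2 : ℕ) : ℝ) - k) * (g (k + 1) - g k)) *
        ((W.choose k : ℝ) * V.choose (m + 2 - k)) := by
    rw [sum_mul_choose_left W V (m + 1), mul_assoc,
      ← sum_mul_choose_right (W - 1) V m fun k => g (k + 1 + 1) - g (k + 1)]
    congr 1
    refine sum_congr rfl fun k _ => ?_
    push_cast
    ring
  have hs := sum_choose_stein W V (m + 2) g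
  rw [hred, eq_div_iff (by positivity), sum_mul, ← sub_eq_zero, ← sum_sub_distrib, ← hs]
  refine sum_congr rfl fun k _ => ?_
  unfold hyperPMF
  rw [Nat.add_sub_cancel_left]
  field_simp
  linear_combination (-((((m + 2 : ℕ) : ℝ) - k) * g (k + 1) + k * g k)) * hWp *
    ((W.choose k : ℝ) * V.choose (m + 2 - k))

lemma mul_choose_sub_two (W V m : ℕ) (p : ℝ) (hW : 0 < W) (hV : 0 < V)
    (hWp : (W : ℝ) = p * (W + V)) (hT : (0 : ℝ) < W + V - 1) :
    (W * V : ℝ) * (W - 1 + (V - 1)).choose m =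
      ((m + 2 : ℕ) * p * (1 - p)) * ((((m + 2 : ℕ) : ℝ) - 1) / (((W + V : ℕ) : ℝ) - 1)) *
      ((W + V : ℝ) * (W + V).choose (m + 2)) := by
  have c1 := cast_succ_mul_choose (W + V) (m + 1)
  have c2 := cast_succ_mul_choose (W + V - 1) m
  rw [Nat.cast_sub (by omega), show W + V - 1 - 1 = W - 1 + (V - 1) by omega] at c2
  push_cast at c1 c2 ⊢
  have hV' : (V : ℝ) = (1 - p) * (W + V) := by linarith
  have e : (W * V : ℝ) = p * (1 - p) * (W + V) ^ 2 := by
    calc (W * V : ℝ) = (p * (W + V)) * ((1 - p) * (W + V)) := by rw [← hWp, ← hV']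
      _ = _ := by ring
  have hK : ((W - 1 + (V - 1)).choose m : ℝ) =
      (m + 1) * (W + V - 1).choose (m + 1) / (W + V - 1) := by
    rw [eq_div_iff hT.ne']; linear_combination -c2
  rw [e, hK]
  linear_combination (-(p * (1 - p) * (W + V) * ((m + 1) / (W + V - 1)))) * c1

theorem stmt_10 (N W n : ℕ) (hN : 0 < N) (hW : 0 < W) (hn : 0 < n)
    (hWN : W ≤ N) (hnN : n ≤ N) (p : ℝ) (hp : p = (W : ℝ) / N)
    (hp0 : 0 < p) (hp1 : p < 1) (hnp : 1 ≤ n * p * (1 - p)) :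
    (1/28 : ℝ) * (((n : ℝ) - 1) / ((N : ℝ) - 1)) ≤ tvDist N W n p := by
  have hN0 : (0 : ℝ) < N := by exact_mod_cast hN
  have hn0 : (0 : ℝ) < n := by exact_mod_cast hn
  have hWp : (W : ℝ) = p * N := by rw [hp]; field_simp
  have hn4 : 4 ≤ n := by
    have : (4 : ℝ) ≤ n := by
      nlinarith [mul_nonneg hn0.le (sq_nonneg (2 * p - 1))]
    exact_mod_cast this
  have hn4' : (4 : ℝ) ≤ n := by exact_mod_cast hn4
  have hnN' : (n : ℝ) ≤ N := by exact_mod_cast hnN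
  have hWN' : W < N := by
    have : (W : ℝ) < N := by rw [hWp]; nlinarith
    exact_mod_cast this
  obtain ⟨V, rfl⟩ := Nat.exists_eq_add_of_le hWN
  have hV : 0 < V := by omega
  have hch : (0 : ℝ) < (W + V).choose n := by exact_mod_cast Nat.choose_pos hnN
  have hVr : ((W + V : ℕ) : ℝ) = W + V := by push_cast; ring
  set v : ℝ := n * p * (1 - p) with hv
  set C : ℝ := 4 * v + 1 with hC
  set g : ℕ → ℝ := fun k => steinTest C (k - n * p) with hg
  have hg1 : ∀ k : ℕ, g (k + 1) = steinTest C ((k - n * p) + 1) := fun k => by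
    simp only [hg]; push_cast; congr 1; ring
  set f : ℕ → ℝ := fun k => p * (n - k) * g (k + 1) - (1 - p) * k * g k with hf
  have hfe : ∀ k : ℕ, f k = v * (g (k + 1) - g k)
      - (p * ((k - n * p) * g (k + 1)) + (1 - p) * ((k - n * p) * g k)) := fun k => by
    simp only [hf, hv]; ring
  have hC0 : 0 < C := by linarith
  have hsum : ∑ k ∈ range (n + 1), (hyperPMF (W + V) W n k - binomPMF n p k) = 0 := by
    rw [sum_sub_distrib, sum_binomPMF]
    unfold hyperPMF
    rw [← sum_div, Nat.add_sub_cancel_left, sum_choose_mul_choose, div_self hch.ne', sub_self]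
  have htv := sum_mul_sub_le_tvDist (W + V) W n p f (-(C + 1 / 16 + v / 8)) (v + 1 / 16)
    (fun k _ => by
      rw [hfe, hg1]
      have h1 := neg_le_steinTest_sub (by linarith : 1 ≤ C) (k - n * p)
      have h2 := mul_steinTest_le hC0 (k - n * p)
      have h3 := mul_steinTest_succ_le hC0 (k - n * p)
      nlinarith [mul_le_mul_of_nonneg_left h1 (by linarith : 0 ≤ v),
        mul_le_mul_of_nonneg_left h3 hp0.le,
        mul_le_mul_of_nonneg_left h2 (by linarith : 0 ≤ 1 - p)])
    (fun k _ => by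
      rw [hfe, hg1]
      have h1 := steinTest_sub_le (by linarith : 1 ≤ C) (k - n * p)
      have h2 := neg_le_mul_steinTest hC0 (k - n * p)
      have h3 := neg_le_mul_steinTest_succ hC0 (k - n * p)
      nlinarith [mul_le_mul_of_nonneg_left h1 (by linarith : 0 ≤ v),
        mul_le_mul_of_nonneg_left h3 hp0.le,
        mul_le_mul_of_nonneg_left h2 (by linarith : 0 ≤ 1 - p)])
    hsum
  simp only [mul_sub, sum_sub_distrib] at htv
  rw [sum_binomPMF_stein, sub_zero] at htv
  obtain ⟨m, rfl⟩ := Nat.exists_eq_add_of_le' (show 2 ≤ n by omega)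
  rw [hVr] at hWp
  have hE := sum_hyperPMF_stein W V m p hW hWp hnN g
  rw [← hVr] at hWp
  have hmom := sum_sq_choose_mul_choose (W - 1) (V - 1) m (1 - ((m + 2 : ℕ) : ℝ) * p)
    (by omega) (by omega)
  have hmass := sum_choose_mul_choose (W - 1) (V - 1) m
  have hmle := shifted_second_moment_le hWp hn4' hnN' hp0 hp1
  set K : ℝ := ((W - 1 + (V - 1)).choose m : ℝ) with hK
  have hK0 : 0 ≤ K := by positivity
  have hmom' : ∑ k ∈ range (m + 1), ((k : ℝ) + (1 - ((m + 2 : ℕ) : ℝ) * p)) ^ 2 *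
      (((W - 1).choose k : ℝ) * (V - 1).choose (m - k)) ≤ K * (v + 1) := by
    rw [hmom]
    refine mul_le_mul_of_nonneg_left (le_trans (le_of_eq ?_) hmle) hK0
    rw [Nat.cast_sub (by omega), Nat.cast_sub (by omega)]
    push_cast
    congr 3 <;> ring
  have hlow : K * (7 / 10 - 9 / (8 * (C + 1 / 4)) * (v + 1)) ≤
      ∑ k ∈ range (m + 1), (g (k + 1 + 1) - g (k + 1)) *
        (((W - 1).choose k : ℝ) * (V - 1).choose (m - k)) := by
    calc K * (7 / 10 - 9 / (8 * (C + 1 / 4)) * (v + 1))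
        = 7 / 10 * K - 9 / (8 * (C + 1 / 4)) * (K * (v + 1)) := by ring
      _ ≤ 7 / 10 * K - 9 / (8 * (C + 1 / 4)) * _ :=
        sub_le_sub_left (mul_le_mul_of_nonneg_left hmom' (by positivity)) _
      _ = ∑ k ∈ range (m + 1), (7 / 10 - 9 / (8 * (C + 1 / 4)) *
            ((k : ℝ) + (1 - ((m + 2 : ℕ) : ℝ) * p)) ^ 2) *
            (((W - 1).choose k : ℝ) * (V - 1).choose (m - k)) := by
        rw [← hmass, mul_sum, mul_sum, ← sum_sub_distrib]
        exact sum_congr rfl fun k _ => by ring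
      _ ≤ _ := by
        refine sum_le_sum fun k _ => mul_le_mul_of_nonneg_right ?_ (by positivity)
        have h := linear_le_steinTest_sub (by linarith : 5 ≤ C)
          (((k + 1 : ℕ) : ℝ) - ((m + 2 : ℕ) : ℝ) * p)
        rw [← hg1] at h
        refine le_trans (le_of_eq ?_) h
        push_cast
        ring
  have hN1 : (0 : ℝ) < ((W + V : ℕ) : ℝ) - 1 := by linarith
  have hconst := mul_choose_sub_two W V m p hW hV (by rw [← hVr]; exact hWp)
    (by rw [← hVr]; exact hN1)
  rw [← hK, ← hv] at hconst
  set θ : ℝ := (((m + 2 : ℕ) : ℝ) - 1) / (((W + V : ℕ) : ℝ) - 1) with hθ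
  have hθ0 : 0 ≤ θ := div_nonneg (by linarith) hN1.le
  have hE' : v * θ * (7 / 10 - 9 / (8 * (C + 1 / 4)) * (v + 1)) ≤
      ∑ k ∈ range (m + 2 + 1), f k * hyperPMF (W + V) W (m + 2) k := by
    rw [hE, le_div_iff₀ (by rw [← hVr]; positivity)]
    calc _ = (W * V : ℝ) * K * (7 / 10 - 9 / (8 * (C + 1 / 4)) * (v + 1)) := by
          rw [hconst]; ring
      _ ≤ _ := by
          rw [mul_assoc]
          exact mul_le_mul_of_nonneg_left hlow (by positivity)
  have hR : 0 < v + 1 / 16 - -(C + 1 / 16 + v / 8) := by linarith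
  refine le_of_mul_le_mul_left (le_trans ?_ (hE'.trans htv)) hR
  calc (v + 1 / 16 - -(C + 1 / 16 + v / 8)) * (1 / 28 * θ)
      = θ * ((v + 1 / 16 - -(C + 1 / 16 + v / 8)) / 28) := by ring
    _ ≤ θ * (v * (7 / 10 - 9 / (8 * (C + 1 / 4)) * (v + 1))) :=
      mul_le_mul_of_nonneg_left (stein_range_div_le hnp) hθ0
    _ = _ := by ring
end

section
/- Let Y be hypergeometrically distributed H(N, W, n) and Z binomially distributed B(n, p) with p = W/N. Suppose n ≥ 16, 1/n ≤ p ≤ 1/4, np(1−p) ≥ 1, and (n−1)/(N−1) ≤ c/d ≤ 1/80 for some c, d. Then P(Y ≤ np − (1/2)√(np)) ≥ 3/160 − c/d ≥ 1/80. -/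
open scoped Classical

/-- The weight `B` in the discrete Pearson recurrence
`B (k + 1) h (k + 1) = B k h k + (μ - k) h k` of the hypergeometric distribution. -/
noncomputable def pearsonWeight (q t : ℝ) (k : ℕ) : ℝ := k * (q + t * k)

/-- A weight function on `{0, …, n}` with total mass one and mean `μ` that satisfies a
discrete Pearson recurrence. -/
structure IsPearson (h : ℕ → ℝ) (n : ℕ) (μ q t : ℝ) : Prop where
  nonneg : ∀ k, 0 ≤ h k
  sum_eq_one : ∑ k ∈ Finset.range (n + 1), h k = 1
  step : ∀ k < n, pearsonWeight q t (k + 1) * h (k + 1) =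
    pearsonWeight q t k * h k + (μ - k) * h k
  last : pearsonWeight q t n * h n + (μ - n) * h n = 0

namespace IsPearson

variable {h : ℕ → ℝ} {n : ℕ} {μ q t : ℝ}

lemma sum_stein_partial (H : IsPearson h n μ q t) (f : ℝ → ℝ) (j : ℕ) (hj : j ≤ n) :
    ∑ k ∈ Finset.range j, h k * ((μ - k) * f k) =
      pearsonWeight q t j * h j * f (j - 1) -
        ∑ k ∈ Finset.range j, pearsonWeight q t k * h k * (f k - f (k - 1)) := by
  induction j with
  | zero => simp [pearsonWeight]
  | succ j ih =>
    rw [Finset.sum_range_succ, Finset.sum_range_succ, ih (by omega), H.step j (by omega)]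
    push_cast
    rw [add_sub_cancel_right]
    ring

/-- Summation by parts (Stein identity). -/
lemma sum_stein (H : IsPearson h n μ q t) (f : ℝ → ℝ) :
    ∑ k ∈ Finset.range (n + 1), h k * ((k - μ) * f k) =
      ∑ k ∈ Finset.range (n + 1), pearsonWeight q t k * h k * (f k - f (k - 1)) := by
  have h1 := H.sum_stein_partial f n le_rfl
  have h2 : ∑ k ∈ Finset.range n, h k * ((k - μ) * f k) =
      -∑ k ∈ Finset.range n, h k * ((μ - k) * f k) := by
    rw [← Finset.sum_neg_distrib]
    exact Finset.sum_congr rfl fun k _ => by ring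
  rw [Finset.sum_range_succ, Finset.sum_range_succ, h2, h1]
  linear_combination -(f n) * H.last

lemma sum_partial (H : IsPearson h n μ q t) (m : ℕ) (hm : m < n) :
    ∑ k ∈ Finset.range (m + 1), h k * (μ - k) =
      pearsonWeight q t (m + 1) * h (m + 1) := by
  simpa using H.sum_stein_partial (fun _ => 1) (m + 1) hm

/-- The central moments. -/
noncomputable def centralSum (h : ℕ → ℝ) (n : ℕ) (μ : ℝ) (j : ℕ) : ℝ :=
  ∑ k ∈ Finset.range (n + 1), h k * ((k : ℝ) - μ) ^ j

lemma centralSum_zero (H : IsPearson h n μ q t) : centralSum h n μ 0 = 1 := by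
  simpa [centralSum] using H.sum_eq_one

lemma centralSum_one (H : IsPearson h n μ q t) : centralSum h n μ 1 = 0 := by
  simpa [centralSum] using H.sum_stein (fun _ => 1)

lemma centralSum_two (H : IsPearson h n μ q t) :
    centralSum h n μ 2 * (1 - t) = μ * (q + t * μ) := by
  have h1 := H.sum_stein (fun x => x - μ)
  have h2 : centralSum h n μ 2 = μ * (q + t * μ) * centralSum h n μ 0 +
      (q + 2 * t * μ) * centralSum h n μ 1 + t * centralSum h n μ 2 := by
    simp only [centralSum, Finset.mul_sum, ← Finset.sum_add_distrib]
    refine Eq.trans ?_ (h1.trans ?_)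
    · exact Finset.sum_congr rfl fun k _ => by ring
    · exact Finset.sum_congr rfl fun k _ => by simp only [pearsonWeight]; ring
  rw [H.centralSum_zero, H.centralSum_one] at h2
  linarith

lemma centralSum_three (H : IsPearson h n μ q t) :
    centralSum h n μ 3 * (1 - 2 * t) =
      centralSum h n μ 2 * (2 * (q + 2 * t * μ) - 1) := by
  have h1 := H.sum_stein (fun x => (x - μ) ^ 2)
  have h2 : centralSum h n μ 3 = - (μ * (q + t * μ)) * centralSum h n μ 0 +
      (2 * (μ * (q + t * μ)) - (q + 2 * t * μ)) * centralSum h n μ 1 +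
      (2 * (q + 2 * t * μ) - t) * centralSum h n μ 2 + 2 * t * centralSum h n μ 3 := by
    simp only [centralSum, Finset.mul_sum, ← Finset.sum_add_distrib]
    refine Eq.trans ?_ (h1.trans ?_)
    · exact Finset.sum_congr rfl fun k _ => by ring
    · exact Finset.sum_congr rfl fun k _ => by simp only [pearsonWeight]; ring
  rw [H.centralSum_zero, H.centralSum_one] at h2
  linarith [H.centralSum_two]

lemma centralSum_four (H : IsPearson h n μ q t) :
    centralSum h n μ 4 * (1 - 3 * t) =
      3 * (1 - t) * centralSum h n μ 2 ^ 2 + centralSum h n μ 2 * (1 - 3 * (q + 2 * t * μ)) +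
        3 * (q + 2 * t * μ - t) * centralSum h n μ 3 := by
  have h1 := H.sum_stein (fun x => (x - μ) ^ 3)
  have h2 : centralSum h n μ 4 = (μ * (q + t * μ)) * centralSum h n μ 0 +
      (-3 * (μ * (q + t * μ)) + (q + 2 * t * μ)) * centralSum h n μ 1 +
      (3 * (μ * (q + t * μ)) - 3 * (q + 2 * t * μ) + t) * centralSum h n μ 2 +
      (3 * (q + 2 * t * μ) - 3 * t) * centralSum h n μ 3 + 3 * t * centralSum h n μ 4 := by
    simp only [centralSum, Finset.mul_sum, ← Finset.sum_add_distrib]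
    refine Eq.trans ?_ (h1.trans ?_)
    · exact Finset.sum_congr rfl fun k _ => by ring
    · exact Finset.sum_congr rfl fun k _ => by simp only [pearsonWeight]; ring
  rw [H.centralSum_zero, H.centralSum_one] at h2
  linear_combination h2 - (1 + 3 * centralSum h n μ 2) * H.centralSum_two

lemma centralSum_four_le (H : IsPearson h n μ q t) (ht0 : 0 ≤ t) (ht : t ≤ 1 / 2400)
    (hb : t ≤ 2 * (q + 2 * t * μ) * (1 - (q + 2 * t * μ)))
    (hvar : 159 / 160 ≤ centralSum h n μ 2) :
    centralSum h n μ 4 ≤ 402 / 100 * centralSum h n μ 2 ^ 2 := by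
  have h3 := H.centralSum_three
  have h4 := H.centralSum_four
  set v := centralSum h n μ 2
  set b := q + 2 * t * μ
  have key : (b - t) * centralSum h n μ 3 ≤ b * v := by
    have hpos : 0 < 1 - 2 * t := by linarith
    refine le_of_mul_le_mul_right ?_ hpos
    have : (b - t) * centralSum h n μ 3 * (1 - 2 * t) = v * ((b - t) * (2 * b - 1)) := by
      rw [mul_assoc, h3]; ring
    rw [this]
    have : (b - t) * (2 * b - 1) ≤ b * (1 - 2 * t) := by linarith
    nlinarith
  have hv2 : v ≤ 160 / 159 * v ^ 2 := by nlinarith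
  have h5 : centralSum h n μ 4 * (1 - 3 * t) ≤ (3 + 160 / 159) * v ^ 2 := by
    nlinarith [mul_nonneg ht0 (sq_nonneg v)]
  have hpos : 0 < 1 - 3 * t := by linarith
  refine le_of_mul_le_mul_right (h5.trans ?_) hpos
  nlinarith [sq_nonneg v]

lemma sum_abs (H : IsPearson h n μ q t) (M : ℕ) (hMn : M ≤ n) (hM : (M : ℝ) ≤ μ)
    (hM' : μ < M + 1) :
    ∑ k ∈ Finset.range (n + 1), h k * |(k : ℝ) - μ| =
      2 * ∑ k ∈ Finset.range (M + 1), h k * (μ - k) := by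
  have h1 := H.centralSum_one
  have h2 : ∑ k ∈ Finset.range (n + 1), h k * max (μ - k) 0 =
      ∑ k ∈ Finset.range (M + 1), h k * (μ - k) := by
    symm
    refine Finset.sum_subset_zero_on_sdiff (Finset.range_mono (by omega)) ?_ ?_
    · intro k hk
      simp only [Finset.mem_sdiff, Finset.mem_range, not_lt] at hk
      have : ((M + 1 : ℕ) : ℝ) ≤ k := by exact_mod_cast hk.2
      push_cast at this
      rw [max_eq_right (by linarith), mul_zero]
    · intro k hk
      have : (k : ℝ) ≤ M := by exact_mod_cast Nat.lt_succ_iff.mp (Finset.mem_range.mp hk)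
      rw [max_eq_left (by linarith)]
  have h3 : ∑ k ∈ Finset.range (n + 1), h k * |(k : ℝ) - μ| =
      2 * ∑ k ∈ Finset.range (n + 1), h k * max (μ - k) 0 + centralSum h n μ 1 := by
    simp only [centralSum, Finset.mul_sum, ← Finset.sum_add_distrib]
    refine Finset.sum_congr rfl fun k _ => ?_
    rcases le_total ((k : ℝ) - μ) 0 with hk | hk
    · rw [abs_of_nonpos hk, max_eq_left (by linarith)]; ring
    · rw [abs_of_nonneg hk, max_eq_right (by linarith)]; ring
  rw [h3, h1, h2, add_zero]

lemma centralSum_two_le (H : IsPearson h n μ q t) {κ : ℝ} (hκ : 0 < κ)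
    (hv : 0 < centralSum h n μ 2)
    (h4 : centralSum h n μ 4 ≤ κ * centralSum h n μ 2 ^ 2) :
    centralSum h n μ 2 ≤ κ * (∑ k ∈ Finset.range (n + 1), h k * |(k : ℝ) - μ|) ^ 2 := by
  set v := centralSum h n μ 2 with hvdef
  set E := ∑ k ∈ Finset.range (n + 1), h k * |(k : ℝ) - μ| with hE
  set u := Real.sqrt (κ * v) with hu
  have hu0 : 0 < u := Real.sqrt_pos.mpr (by positivity)
  have hu2 : u ^ 2 = κ * v := Real.sq_sqrt (by positivity)
  have h1 : 3 * u ^ 2 * v - centralSum h n μ 4 ≤ 2 * u ^ 3 * E := by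
    simp only [hvdef, hE, centralSum, Finset.mul_sum, ← Finset.sum_sub_distrib]
    refine Finset.sum_le_sum fun k _ => ?_
    set x := |(k : ℝ) - μ| with hx
    have hx0 : 0 ≤ x := abs_nonneg _
    have e2 : ((k : ℝ) - μ) ^ 2 = x ^ 2 := (sq_abs _).symm
    have e4 : ((k : ℝ) - μ) ^ 4 = x ^ 4 := by
      rw [show ((k : ℝ) - μ) ^ 4 = (((k : ℝ) - μ) ^ 2) ^ 2 by ring, e2]; ring
    rw [e2, e4]
    have : 0 ≤ h k * (x * ((x - u) ^ 2 * (x + 2 * u))) :=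
      mul_nonneg (H.nonneg k) (by positivity)
    linarith
  have h2 : v ≤ u * E := by
    have : 2 * u ^ 2 * v ≤ 2 * u ^ 2 * (u * E) := by
      have : κ * v ^ 2 = u ^ 2 * v := by rw [hu2]; ring
      linarith
    exact le_of_mul_le_mul_left this (by positivity)
  have h3 : v ^ 2 ≤ κ * v * E ^ 2 := by
    rw [← hu2, ← mul_pow]
    exact pow_le_pow_left₀ hv.le h2 2
  refine le_of_mul_le_mul_left ?_ hv
  linarith

lemma sq_sum_partial_le (H : IsPearson h n μ q t) (m : ℕ) (hm : m ≤ n) :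
    (∑ k ∈ Finset.range (m + 1), h k * (μ - k)) ^ 2 ≤
      (∑ k ∈ Finset.range (m + 1), h k) * centralSum h n μ 2 := by
  refine (Finset.sum_sq_le_sum_mul_sum_of_sq_le_mul _ (g := fun k => h k * ((k : ℝ) - μ) ^ 2)
    (fun k _ => H.nonneg k) (fun k _ => mul_nonneg (H.nonneg k) (sq_nonneg _))
    (fun k _ => by ring_nf; rfl)).trans ?_
  refine mul_le_mul_of_nonneg_left ?_ (Finset.sum_nonneg fun k _ => H.nonneg k)
  exact Finset.sum_le_sum_of_subset_of_nonneg (Finset.range_mono (by omega))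
    fun k _ _ => mul_nonneg (H.nonneg k) (sq_nonneg _)

lemma sum_partial_succ_le (H : IsPearson h n μ q t) (m : ℕ) (hm : m < n) {r : ℝ}
    (hr : μ - (m + 1) ≤ r * pearsonWeight q t (m + 1)) :
    ∑ k ∈ Finset.range (m + 2), h k * (μ - k) ≤
      (1 + r) * ∑ k ∈ Finset.range (m + 1), h k * (μ - k) := by
  have h1 := H.sum_partial m hm
  rw [Finset.sum_range_succ, add_mul, one_mul, add_le_add_iff_left, h1]
  push_cast
  nlinarith [H.nonneg (m + 1)]

/-- The partial first moments grow at most exponentially. -/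
lemma sum_partial_add_le (H : IsPearson h n μ q t) (m j : ℕ) (hj : m + j ≤ n) {a : ℝ}
    (ha : 0 < a) (hμ : (m : ℝ) + j ≤ μ) (hm : 0 ≤ ∑ k ∈ Finset.range (m + 1), h k * (μ - k))
    (hB : ∀ k, m < k → k ≤ n → a ≤ pearsonWeight q t k) :
    ∑ k ∈ Finset.range (m + j + 1), h k * (μ - k) ≤
      Real.exp ((j * (μ - m - 1) - j * (j - 1) / 2) / a) *
        ∑ k ∈ Finset.range (m + 1), h k * (μ - k) := by
  induction j with
  | zero => simp
  | succ j ih =>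
    push_cast at hμ
    have h1 := ih (by omega) (by linarith)
    have h2 : ∑ k ∈ Finset.range (m + j + 2), h k * (μ - k) ≤
        (1 + (μ - (m + j + 1)) / a) * ∑ k ∈ Finset.range (m + j + 1), h k * (μ - k) := by
      refine H.sum_partial_succ_le (m + j) (by omega) ?_
      push_cast
      rw [div_mul_eq_mul_div, le_div_iff₀ ha]
      exact mul_le_mul_of_nonneg_left (hB _ (by omega) (by omega)) (by linarith)
    have hd : 0 ≤ (μ - (m + j + 1)) / a := div_nonneg (by linarith) ha.le
    have h3 : 1 + (μ - (m + j + 1)) / a ≤ Real.exp ((μ - (m + j + 1)) / a) := by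
      rw [add_comm]; exact Real.add_one_le_exp _
    refine h2.trans ((mul_le_mul_of_nonneg_left h1 (by linarith)).trans ?_)
    refine (mul_le_mul_of_nonneg_right h3 (mul_nonneg (Real.exp_pos _).le hm)).trans ?_
    rw [← mul_assoc, ← Real.exp_add]
    refine le_of_eq ?_
    congr 2
    push_cast
    field_simp
    ring

lemma exp_113_div_200_le : Real.exp (113 / 200) ≤ 9 / 5 := by
  have h := Real.exp_bound' (x := 113 / 200) (by norm_num) (by norm_num) (n := 4) (by norm_num)
  refine h.trans ?_
  norm_num [Finset.sum_range_succ, Nat.factorial]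

/-- Comparing the partial first moments up to `μ - √μ / 2` and up to `μ`. -/
lemma sum_floor_le (H : IsPearson h n μ q t) (hn : 16 ≤ n) (ht : 0 ≤ t)
    (hμ1 : 1 ≤ μ) (hμn : μ ≤ n / 4) (hq : 1 - μ / n - 1 / 160 ≤ q + t) (m : ℕ)
    (hm : (m : ℝ) ≤ μ - 1 / 2 * Real.sqrt μ) (hm' : μ - 1 / 2 * Real.sqrt μ < m + 1) :
    ∑ k ∈ Finset.range (⌊μ⌋₊ + 1), h k * (μ - k) ≤
      9 / 5 * ∑ k ∈ Finset.range (m + 1), h k * (μ - k) := by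
  obtain ⟨s, hs0, hs⟩ : ∃ s : ℝ, 0 ≤ s ∧ s = 1 / 2 * Real.sqrt μ := ⟨_, by positivity, rfl⟩
  have hsμ : μ = 4 * s ^ 2 := by
    rw [hs, mul_pow, Real.sq_sqrt (by linarith)]; ring
  rw [← hs] at hm hm'
  have hn' : (16 : ℝ) ≤ n := by exact_mod_cast hn
  have hM := Nat.floor_le (show 0 ≤ μ by linarith)
  have hM' := Nat.lt_floor_add_one μ
  set M := ⌊μ⌋₊
  have hmM : m ≤ M := Nat.le_floor (by linarith)
  have hMn : M ≤ n := by
    have : (M : ℝ) ≤ n := by linarith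
    exact_mod_cast this
  have hnonneg : 0 ≤ ∑ k ∈ Finset.range (m + 1), h k * (μ - k) := by
    refine Finset.sum_nonneg fun k hk => mul_nonneg (H.nonneg k) ?_
    have : (k : ℝ) ≤ m := by exact_mod_cast Nat.lt_succ_iff.mp (Finset.mem_range.mp hk)
    linarith
  have hs12 : 1 / 2 ≤ s := by nlinarith
  have hμdn : μ / n ≤ 1 / 4 := by
    rw [div_le_iff₀ (by linarith)]; linarith
  have hweight : ∀ k : ℕ, 1 ≤ k → (1 - μ / n - 1 / 160) * k ≤ pearsonWeight q t k := by
    intro k hk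
    have hk' : (1 : ℝ) ≤ k := by exact_mod_cast hk
    unfold pearsonWeight
    nlinarith [mul_nonneg ht (by linarith : (0 : ℝ) ≤ k - 1)]
  rcases le_or_gt (9 / 10) s with hbig | hsmall
  · obtain ⟨j, hj⟩ : ∃ j, M = m + j := ⟨M - m, by omega⟩
    have hjM : (m : ℝ) + j ≤ μ := by
      have : (M : ℝ) = m + j := by exact_mod_cast hj
      linarith
    have hμs : s ≤ μ := by nlinarith
    have ha : 0 < 119 / 160 * (μ - s) := by nlinarith
    have h1 := H.sum_partial_add_le m j (by omega) ha hjM hnonneg (by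
      intro k hk _
      have hk' : (m : ℝ) + 1 ≤ k := by exact_mod_cast hk
      refine le_trans ?_ (hweight k (by omega))
      exact mul_le_mul (by linarith) (by linarith) (by linarith) (by linarith))
    rw [hj]
    refine h1.trans (mul_le_mul_of_nonneg_right ?_ hnonneg)
    have h2 : (j * (μ - m - 1) - j * (j - 1) / 2 : ℝ) / (119 / 160 * (μ - s)) ≤ 113 / 200 := by
      rw [div_le_iff₀ ha]
      have e1 : (j * (μ - m - 1) - j * (j - 1) / 2 : ℝ) ≤ (μ - m - 1 / 2) ^ 2 / 2 := by
        linarith [sq_nonneg (μ - m - 1 / 2 - j)]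
      have e2 : (μ - m - 1 / 2) ^ 2 ≤ (s + 1 / 2) ^ 2 :=
        pow_le_pow_left₀ (by linarith) (by linarith) 2
      have e3 : (s + 1 / 2) ^ 2 / 2 ≤ 113 / 200 * (119 / 160 * (μ - s)) := by
        rw [hsμ]; linarith [sq_nonneg (s - 9 / 10)]
      linarith
    exact (Real.exp_le_exp.mpr h2).trans exp_113_div_200_le
  · have hMm : M ≤ m + 1 := by
      have : (M : ℝ) < m + 2 := by linarith
      have : M < m + 2 := by exact_mod_cast this
      omega
    rcases hmM.eq_or_lt with h0 | h0
    · rw [← h0]; linarith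
    have hM1 : M = m + 1 := by omega
    have hMr : (M : ℝ) = m + 1 := by exact_mod_cast hM1
    rw [hM1]
    refine (H.sum_partial_succ_le m (by omega) (r := 4 / 5) ?_).trans
      (le_of_eq (by norm_num))
    have h1 := hweight (m + 1) (by omega)
    push_cast at h1
    suffices h2 : μ - (m + 1) ≤ 4 / 5 * ((1 - μ / n - 1 / 160) * (m + 1)) by linarith
    rcases Nat.eq_zero_or_pos m with rfl | hpos
    · have hs1 : s ≤ 641 / 1000 := by
        norm_num at hm'
        nlinarith
      have : μ / n ≤ μ / 16 := div_le_div_of_nonneg_left (by linarith) (by norm_num) hn'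
      norm_num at hm' ⊢
      linarith
    · have hpos' : (1 : ℝ) ≤ m := by exact_mod_cast hpos
      nlinarith

lemma lower_tail (H : IsPearson h n μ q t) (hn : 16 ≤ n) (ht : 0 ≤ t) (ht' : t ≤ 1 / 2400)
    (hμ1 : 1 ≤ μ) (hμn : μ ≤ n / 4) (hq : 1 - μ / n - 1 / 160 ≤ q + t)
    (hb : t ≤ 2 * (q + 2 * t * μ) * (1 - (q + 2 * t * μ)))
    (hvar : 159 / 160 ≤ centralSum h n μ 2) (m : ℕ)
    (hm : (m : ℝ) ≤ μ - 1 / 2 * Real.sqrt μ) (hm' : μ - 1 / 2 * Real.sqrt μ < m + 1) :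
    3 / 160 ≤ ∑ k ∈ Finset.range (m + 1), h k := by
  have hn' : (16 : ℝ) ≤ n := by exact_mod_cast hn
  have hfl := Nat.floor_le (show 0 ≤ μ by linarith)
  have hmul : (m : ℝ) ≤ μ := hm.trans (by linarith [Real.sqrt_nonneg μ])
  have hMn : ⌊μ⌋₊ ≤ n := by
    have : (⌊μ⌋₊ : ℝ) ≤ n := by linarith
    exact_mod_cast this
  have hmn : m ≤ n := (Nat.le_floor hmul).trans hMn
  have h1 := H.sum_floor_le hn ht hμ1 hμn hq m hm hm'
  have h2 := H.centralSum_two_le (by norm_num) (by linarith)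
    (H.centralSum_four_le ht ht' hb hvar)
  rw [H.sum_abs _ hMn hfl (Nat.lt_floor_add_one μ)] at h2
  have h3 := H.sq_sum_partial_le m hmn
  have h0 : 0 ≤ ∑ k ∈ Finset.range (⌊μ⌋₊ + 1), h k * (μ - k) := by
    refine Finset.sum_nonneg fun k hk => mul_nonneg (H.nonneg k) ?_
    have : (k : ℝ) ≤ ⌊μ⌋₊ := by exact_mod_cast Nat.lt_succ_iff.mp (Finset.mem_range.mp hk)
    linarith
  have h4 := pow_le_pow_left₀ h0 h1 2
  have hv : 0 < centralSum h n μ 2 := by linarith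
  refine le_of_mul_le_mul_right ?_ hv
  rw [mul_pow] at h4 h2
  linarith

end IsPearson

lemma hyperPMF_nonneg (N W n k : ℕ) : 0 ≤ hyperPMF N W n k := by
  unfold hyperPMF; positivity

lemma sum_hyperPMF {N W n : ℕ} (hWN : W ≤ N) (hnN : n ≤ N) :
    ∑ k ∈ Finset.range (n + 1), hyperPMF N W n k = 1 := by
  have h1 := Nat.add_choose_eq W (N - W) n
  rw [Nat.add_sub_cancel' hWN, Finset.Nat.sum_antidiagonal_eq_sum_range_succ_mk] at h1
  have h2 : (N.choose n : ℝ) ≠ 0 := by exact_mod_cast (Nat.choose_pos hnN).ne'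
  simp only [hyperPMF, ← Finset.sum_div]
  rw [div_eq_one_iff_eq h2, h1]
  push_cast
  rfl

lemma cast_choose_succ_mul (a k : ℕ) :
    (a.choose (k + 1) : ℝ) * (k + 1) = a.choose k * ((a : ℝ) - k) := by
  rcases le_or_gt k a with h | h
  · have := Nat.choose_succ_right_eq a k
    rw [← Nat.cast_sub h]
    exact_mod_cast this
  · simp [Nat.choose_eq_zero_of_lt h, Nat.choose_eq_zero_of_lt (h.trans (Nat.lt_succ_self k))]

lemma hyperPMF_succ {N W n k : ℕ} (hWN : W ≤ N) (hk : k < n) :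
    ((k : ℝ) + 1) * (N - W - n + (k + 1)) * hyperPMF N W n (k + 1) =
      (W - k) * (n - k) * hyperPMF N W n k := by
  obtain ⟨j, rfl⟩ : ∃ j, n = k + 1 + j := ⟨n - (k + 1), by omega⟩
  have h1 := cast_choose_succ_mul W k
  have h2 := cast_choose_succ_mul (N - W) j
  rw [Nat.cast_sub hWN] at h2
  unfold hyperPMF
  rw [show k + 1 + j - (k + 1) = j by omega, show k + 1 + j - k = j + 1 by omega]
  push_cast
  rw [mul_div_assoc', mul_div_assoc']
  congr 1
  linear_combination ((N : ℝ) - W - j) * (N - W).choose j * h1 -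
    (W - k) * W.choose k * h2

lemma isPearson_hyperPMF {N W n : ℕ} (hWN : W ≤ N) (hnN : n ≤ N) (hN : 0 < N) :
    IsPearson (hyperPMF N W n) n (n * (W / N)) (((N : ℝ) - W - n) / N) (1 / N) where
  nonneg := hyperPMF_nonneg N W n
  sum_eq_one := sum_hyperPMF hWN hnN
  step k hk := by
    have h1 := hyperPMF_succ hWN hk
    have hN' : (N : ℝ) ≠ 0 := by exact_mod_cast hN.ne'
    unfold pearsonWeight
    push_cast
    field_simp
    linear_combination h1
  last := by
    have hN' : (N : ℝ) ≠ 0 := by exact_mod_cast hN.ne'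
    unfold pearsonWeight
    field_simp
    ring

/-- If `Y ~ H(N,W,n)` with `p = W/N`, `n ≥ 16`, `1/n ≤ p ≤ 1/4`, `np(1-p) ≥ 1`
and `(n-1)/(N-1) ≤ c/d` (where `c ∈ (1/84,1/80]` and `d ≥ 2`, so `c/d ≤ 1/160 ≤ 1/80`),
then `P(Y ≤ np − (1/2)√(np)) ≥ 3/160 − c/d ≥ 1/80`. -/
theorem stmt_11 (N W n : ℕ) (hWN : W ≤ N) (hnN : n ≤ N) (hn : 16 ≤ n)
    (p : ℝ) (hp : p = (W : ℝ) / N)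
    (hplow : 1 / (n : ℝ) ≤ p) (hphigh : p ≤ 1/4) (hnp : 1 ≤ n * p * (1 - p))
    (c : ℝ) (d : ℕ) (hd : 2 ≤ d) (hc : c ∈ Set.Ioc (1/84 : ℝ) (1/80))
    (hcd : ((n : ℝ) - 1) / ((N : ℝ) - 1) ≤ c / d) :
    (3/160 - c / d ≤
        ∑ m ∈ (Finset.range (n+1)).filter
          (fun m : ℕ => (m : ℝ) ≤ n * p - (1/2) * Real.sqrt (n * p)),
          hyperPMF N W n m)
      ∧ (1/80 : ℝ) ≤ 3/160 - c / d := by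
  have hn' : (16 : ℝ) ≤ n := by exact_mod_cast hn
  have hN16 : (16 : ℝ) ≤ N := by exact_mod_cast hn.trans hnN
  have hN0 : (0 : ℝ) < N := by linarith
  have hd' : (2 : ℝ) ≤ d := by exact_mod_cast hd
  have hcd' : c / d ≤ 1 / 160 := by
    rw [div_le_iff₀ (by linarith)]
    linarith [hc.2]
  refine ⟨?_, by linarith⟩
  have hc0 : 0 ≤ c / d := div_nonneg (by linarith [hc.1]) (by linarith)
  have hnN' : 160 * ((n : ℝ) - 1) ≤ N - 1 := by
    have := hcd.trans hcd'
    rw [div_le_iff₀ (by linarith)] at this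
    linarith
  have H := isPearson_hyperPMF hWN hnN (show 0 < N by omega)
  rw [← hp] at H
  have hp0 : 0 ≤ p := le_trans (by positivity) hplow
  have hWp : (W : ℝ) = p * N := by rw [hp]; field_simp
  have hμ1 : 1 ≤ n * p := by
    rw [div_le_iff₀ (by linarith)] at hplow
    linarith
  have hμn : n * p ≤ (n : ℝ) / 4 := by nlinarith
  set t : ℝ := 1 / N with ht
  have htN : t * N = 1 := by rw [ht]; field_simp
  have ht0 : 0 < t := by positivity
  have ht1 : t ≤ 1 / 2400 := by
    rw [ht]
    exact one_div_le_one_div_of_le (by norm_num) (by linarith)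
  have hq : ((N : ℝ) - W - n) / N = 1 - p - n * t := by
    rw [hWp, ht]; field_simp
  rw [hq] at H
  have hnt : n * t ≤ 1 / 160 + 159 / 160 * t := by nlinarith
  have hvar : 159 / 160 ≤ IsPearson.centralSum (hyperPMF N W n) n (n * p) 2 := by
    have h2 := H.centralSum_two
    refine le_of_mul_le_mul_right ?_ (show 0 < 1 - t by linarith)
    rw [h2]
    have e : n * p * (1 - p - n * t + t * (n * p)) = n * p * (1 - p) * (1 - n * t) := by ring
    rw [e]
    nlinarith
  set m := ⌊n * p - 1 / 2 * Real.sqrt (n * p)⌋₊ with hmdef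
  have hsq : Real.sqrt (n * p) ≤ n * p := by
    rw [Real.sqrt_le_left (by linarith)]
    nlinarith
  have hτ : 0 ≤ n * p - 1 / 2 * Real.sqrt (n * p) := by linarith
  have hb : t ≤ 2 * (1 - p - n * t + 2 * t * (n * p)) *
      (1 - (1 - p - n * t + 2 * t * (n * p))) := by
    have hnt0 : 16 * t ≤ n * t := mul_le_mul_of_nonneg_right hn' ht0.le
    have e1 : 8 * t ≤ 1 - (1 - p - n * t + 2 * t * (n * p)) := by nlinarith
    have e2 : 1 / 2 ≤ 1 - p - n * t + 2 * t * (n * p) := by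
      have : 0 ≤ t * (n * p) := by positivity
      linarith
    nlinarith
  have hmain := H.lower_tail hn ht0.le ht1 hμ1 hμn (by
    rw [mul_div_cancel_left₀ p (by linarith : (n : ℝ) ≠ 0)]
    linarith) hb hvar m (Nat.floor_le hτ) (Nat.lt_floor_add_one _)
  have hset : (Finset.range (n + 1)).filter
      (fun m : ℕ => (m : ℝ) ≤ n * p - (1/2) * Real.sqrt (n * p)) = Finset.range (m + 1) := by
    ext k
    rw [Finset.mem_filter, Finset.mem_range, Finset.mem_range, Nat.lt_succ_iff, Nat.lt_succ_iff,
      hmdef, Nat.le_floor_iff hτ, and_iff_right_iff_imp]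
    intro hk
    have : (k : ℝ) ≤ n := by linarith [Real.sqrt_nonneg (n * p)]
    exact_mod_cast this
  rw [hset]
  linarith
end
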